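/- If C is a two-dimensional subspace of ℂ³ with Π_C S_z Π_C = λ Π_C for a real scalar λ, then λ = 0. (Here S_z = diag(1,0,-1).) -/

import Mathlib

open Matrix

noncomputable def Sz : Matrix (Fin 3) (Fin 3) ℂ :=
  !![1, 0, 0; 0, 0, 0; 0, 0, -1]

theorem aux_exists (P : Matrix (Fin 3) (Fin 3) ℂ) (hidem : P * P = P)
    (hrank : P.rank = 2) (i : Fin 3) : ∃ v : Fin 3 → ℂ, v ≠ 0 ∧ P *ᵥ v = v ∧ v i = 0 := by
  let f : LinearMap.range P.mulVecLin →ₗ[ℂ] ℂ :=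
    (LinearMap.proj i : (Fin 3 → ℂ) →ₗ[ℂ] ℂ).comp (LinearMap.range P.mulVecLin).subtype
  have h : LinearMap.ker f ≠ ⊥ := by
    apply LinearMap.ker_ne_bot_of_finrank_lt
    have h2 : Module.finrank ℂ (LinearMap.range P.mulVecLin) = 2 := hrank
    rw [h2]; simp
  obtain ⟨⟨v, w, hw⟩, hv, hv0⟩ := (Submodule.ne_bot_iff _).1 h
  refine ⟨v, fun h0 => hv0 (Subtype.ext h0), ?_, hv⟩
  rw [← hw, mulVecLin_apply, mulVec_mulVec, hidem]

theorem aux_eq (P : Matrix (Fin 3) (Fin 3) ℂ) (hP : P.IsHermitian)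
    (l : ℝ) (hl : P * Sz * P = (l : ℂ) • P) (v : Fin 3 → ℂ) (hv : P *ᵥ v = v) :
    Complex.normSq (v 0) - Complex.normSq (v 2)
      = l * (Complex.normSq (v 0) + Complex.normSq (v 1) + Complex.normSq (v 2)) := by
  have h1 : star v ᵥ* P = star v := by
    have := star_mulVec P v
    rw [hP.eq, hv] at this
    exact this.symm
  have h2 : star v ⬝ᵥ ((P * Sz * P) *ᵥ v) = star v ⬝ᵥ (Sz *ᵥ v) := by
    rw [← mulVec_mulVec, hv, ← mulVec_mulVec, dotProduct_mulVec, h1]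
  rw [hl, smul_mulVec, hv] at h2
  have h3 := congrArg Complex.re h2
  simp [Sz, dotProduct, mulVec, Fin.sum_univ_three] at h3
  simp only [Complex.normSq_apply]
  linarith

theorem aux_pos (v : Fin 3 → ℂ) (hv : v ≠ 0) :
    0 < Complex.normSq (v 0) + Complex.normSq (v 1) + Complex.normSq (v 2) := by
  have h0 := Complex.normSq_nonneg (v 0)
  have h1 := Complex.normSq_nonneg (v 1)
  have h2 := Complex.normSq_nonneg (v 2)
  by_contra hc
  apply hv
  funext i
  apply Complex.normSq_eq_zero.1
  fin_cases i <;> simp only [Fin.zero_eta, Fin.mk_one, Fin.reduceFinMk] <;> linarith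


/-- If `C` is a two-dimensional subspace of `ℂ³` (represented by its orthogonal projection
`P`, a Hermitian idempotent of rank 2) with `P S_z P = λ P` for a real scalar `λ`,
then `λ = 0`. -/
theorem stmt_1 (P : Matrix (Fin 3) (Fin 3) ℂ) (hP : P.IsHermitian) (hidem : P * P = P)
    (hrank : P.rank = 2) (l : ℝ) (hl : P * Sz * P = (l : ℂ) • P) : l = 0 := by
  obtain ⟨u, hu0, hu, hui⟩ := aux_exists P hidem hrank 2
  obtain ⟨v, hv0, hv, hvi⟩ := aux_exists P hidem hrank 0
  have eu := aux_eq P hP l hl u hu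
  have ev := aux_eq P hP l hl v hv
  have pu := aux_pos u hu0
  have pv := aux_pos v hv0
  have nu := Complex.normSq_nonneg (u 0)
  have nv := Complex.normSq_nonneg (v 2)
  have zu : Complex.normSq (u 2) = 0 := by rw [hui]; simp
  have zv : Complex.normSq (v 0) = 0 := by rw [hvi]; simp
  apply le_antisymm
  · by_contra hc
    have := mul_pos (not_le.1 hc) pv
    linarith
  · by_contra hc
    have := mul_neg_of_neg_of_pos (not_le.1 hc) pu
    linarith
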